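/- arXiv:2412.06981 — 4 statements merged into one kernel-verified Lean document; each statement's English description precedes it below -/
import Mathlib

section
/- Fix x0 ∈ ℝ, s ∈ ℝ, s' ∈ ℝ, σ > 0, σ' > 0, and τ with 0 < τ < σ'. Define the four densities p(x) = φ(x; s·x0, σ²), q(y, x) = φ(y; s'·x0 + (Real.sqrt (σ'² − τ²)/σ)·(x − s·x0), τ²), m(y) = φ(y; s'·x0, σ'²), and r(x, y) = φ(x; s·x0 + (σ·Real.sqrt (σ'² − τ²)/σ'²)·(y − s'·x0), σ²·τ²/σ'²). Then for all x, y ∈ ℝ: q(y, x)·p(x) = r(x, y)·m(y). (This is the Bayes identity establishing that the forward update of the non-Markovian DDIM process, conditional on x(0) and x(t−dt), is the Gaussian with mean s(t)x0 + (σ(t)/σ(t−dt))·√(σ(t−dt)² − τ(t)²)·(x(t−dt) − s(t−dt)x0)/σ(t−dt) and variance σ(t)²τ(t)²/σ(t−dt)².) -/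
open Real

/-- Gaussian probability density with mean `m` and variance `v`. -/
noncomputable def gaussianPDF (m v x : ℝ) : ℝ :=
  (2 * Real.pi * v) ^ (-(1 : ℝ) / 2) * Real.exp (-(x - m) ^ 2 / (2 * v))

/-- Completing the square in the joint exponent of a pair of Gaussian variables, where
`k ^ 2 + τ ^ 2 = σ' ^ 2`. -/
lemma ddim_exponent_identity {σ σ' τ k : ℝ} (hσ : σ ≠ 0) (hσ' : σ' ≠ 0) (hτ : τ ≠ 0)
    (hk : k ^ 2 = σ' ^ 2 - τ ^ 2) (a b : ℝ) :
    -(b - k / σ * a) ^ 2 / (2 * τ ^ 2) + -a ^ 2 / (2 * σ ^ 2) =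
      -(a - σ * k / σ' ^ 2 * b) ^ 2 / (2 * (σ ^ 2 * τ ^ 2 / σ' ^ 2)) +
        -b ^ 2 / (2 * σ' ^ 2) := by
  have key : -(b - k / σ * a) ^ 2 / (2 * τ ^ 2) + -a ^ 2 / (2 * σ ^ 2) -
      (-(a - σ * k / σ' ^ 2 * b) ^ 2 / (2 * (σ ^ 2 * τ ^ 2 / σ' ^ 2)) +
        -b ^ 2 / (2 * σ' ^ 2)) =
      (σ ^ 2 * b ^ 2 - σ' ^ 2 * a ^ 2) * (k ^ 2 - (σ' ^ 2 - τ ^ 2)) /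
        (2 * σ ^ 2 * τ ^ 2 * σ' ^ 2) := by
    field_simp
    ring
  rw [← sub_eq_zero, key, hk, sub_self, mul_zero, zero_div]

/-- A product of two Gaussian densities, with the normalizing constants and the exponents
merged. -/
lemma gaussianPDF_mul_gaussianPDF {v w : ℝ} (hv : 0 ≤ v) (hw : 0 ≤ w) (m n x y : ℝ) :
    gaussianPDF m v x * gaussianPDF n w y =
      ((2 * Real.pi) ^ 2 * (v * w)) ^ (-(1 : ℝ) / 2) *
        Real.exp (-(x - m) ^ 2 / (2 * v) + -(y - n) ^ 2 / (2 * w)) := by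
  have h : (2 * Real.pi) ^ 2 * (v * w) = 2 * Real.pi * v * (2 * Real.pi * w) := by ring
  rw [h, Real.mul_rpow (by positivity) (by positivity), Real.exp_add, gaussianPDF, gaussianPDF]
  ring

/-- Bayes identity for the non-Markovian DDIM process: the forward update,
conditional on `x(0)` and `x(t−dt)`, is the stated Gaussian. -/
theorem ddim_bayes_identity (x0 s s' σ σ' τ : ℝ)
    (hσ : 0 < σ) (hσ' : 0 < σ') (hτ0 : 0 < τ) (hτ : τ < σ')
    (p : ℝ → ℝ) (q : ℝ → ℝ → ℝ) (m : ℝ → ℝ) (r : ℝ → ℝ → ℝ)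
    (hp : ∀ x, p x = gaussianPDF (s * x0) (σ ^ 2) x)
    (hq : ∀ y x, q y x =
      gaussianPDF (s' * x0 + (Real.sqrt (σ' ^ 2 - τ ^ 2) / σ) * (x - s * x0)) (τ ^ 2) y)
    (hm : ∀ y, m y = gaussianPDF (s' * x0) (σ' ^ 2) y)
    (hr : ∀ x y, r x y =
      gaussianPDF (s * x0 + (σ * Real.sqrt (σ' ^ 2 - τ ^ 2) / σ' ^ 2) * (y - s' * x0))
        (σ ^ 2 * τ ^ 2 / σ' ^ 2) x) :
    ∀ x y : ℝ, q y x * p x = r x y * m y := by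
  intro x y
  have hk : Real.sqrt (σ' ^ 2 - τ ^ 2) ^ 2 = σ' ^ 2 - τ ^ 2 :=
    Real.sq_sqrt (sub_nonneg.2 (pow_le_pow_left₀ hτ0.le hτ.le 2))
  have hvar : σ ^ 2 * τ ^ 2 / σ' ^ 2 * σ' ^ 2 = τ ^ 2 * σ ^ 2 := by
    field_simp
  rw [hq, hp, hr, hm, gaussianPDF_mul_gaussianPDF (by positivity) (by positivity),
    gaussianPDF_mul_gaussianPDF (by positivity) (by positivity), hvar]
  simp only [← sub_sub]
  rw [ddim_exponent_identity hσ.ne' hσ'.ne' hτ0.ne' hk]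
end

section
/- Let d ≥ 1, let p₀ be a probability measure on ℝᵈ (with the Euclidean norm), and let σ > 0. Define the Gaussian-smoothed density p_σ(x) = ∫ (2πσ²)^(−d/2) · Real.exp (−‖x − y‖²/(2σ²)) dp₀(y). Then p_σ(x) > 0 for every x, p_σ is differentiable, and the Tweedie formula holds: for every x ∈ ℝᵈ, σ² · ∇(log p_σ)(x) = μ(x) − x, where μ(x) = (1/p_σ(x)) · ∫ y · (2πσ²)^(−d/2) · Real.exp (−‖x − y‖²/(2σ²)) dp₀(y) is the posterior mean of the clean signal given the noisy observation x. -/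
open Real MeasureTheory

section GaussianSmoothing

variable {E : Type*} [NormedAddCommGroup E]

lemma mul_exp_neg_sq_le {s : ℝ} (hs : 0 < s) (r : ℝ) :
    r * Real.exp (-r ^ 2 / (2 * s)) ≤ 1 + s := by
  have hexp : 1 + r ^ 2 / (2 * s) ≤ Real.exp (r ^ 2 / (2 * s)) := by
    linarith [Real.add_one_le_exp (r ^ 2 / (2 * s))]
  rw [neg_div, Real.exp_neg, ← div_eq_mul_inv, div_le_iff₀ (Real.exp_pos _)]
  calc r ≤ (1 + s) * (1 + r ^ 2 / (2 * s)) := by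
        have hdiv : 0 ≤ r ^ 2 / (2 * s) := by positivity
        have hmul : s * (r ^ 2 / (2 * s)) = r ^ 2 / 2 := by field_simp
        nlinarith [sq_nonneg (r - 1)]
    _ ≤ _ := by gcongr

lemma exp_neg_norm_sub_sq_le_one {s : ℝ} (hs : 0 < s) (x y : E) :
    Real.exp (-‖x - y‖ ^ 2 / (2 * s)) ≤ 1 := by
  rw [Real.exp_le_one_iff, neg_div]
  exact neg_nonpos.mpr (by positivity)

lemma norm_gaussian_smul_sub_le [NormedSpace ℝ E] {s c : ℝ} (hs : 0 < s) (hc : 0 < c) (x y : E) :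
    ‖(c * Real.exp (-‖x - y‖ ^ 2 / (2 * s))) • (y - x)‖ ≤ c * (1 + s) := by
  rw [norm_smul, norm_sub_rev y x, Real.norm_of_nonneg (by positivity), mul_assoc,
    mul_comm (Real.exp _)]
  gcongr
  exact mul_exp_neg_sq_le hs _

lemma hasFDerivAt_gaussian [InnerProductSpace ℝ E] (s c : ℝ) (x y : E) :
    HasFDerivAt (fun z => c * Real.exp (-‖z - y‖ ^ 2 / (2 * s)))
      (innerSL ℝ (s⁻¹ • (c * Real.exp (-‖x - y‖ ^ 2 / (2 * s))) • (y - x))) x := by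
  have hsq := ((hasFDerivAt_id (𝕜 := ℝ) x).sub_const y).norm_sq
  have h := ((hsq.neg.mul_const (2 * s)⁻¹).exp).const_mul c
  refine h.congr_fderiv ?_
  ext v
  simp [← neg_sub x y, div_eq_mul_inv, -neg_sub]
  ring

variable [MeasurableSpace E] [BorelSpace E] [SecondCountableTopology E]

lemma integrable_gaussian {s : ℝ} (hs : 0 < s) (c : ℝ) (ν : Measure E) [IsFiniteMeasure ν]
    (x : E) : Integrable (fun y => c * Real.exp (-‖x - y‖ ^ 2 / (2 * s))) ν := by
  refine Integrable.const_mul ?_ c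
  refine Integrable.of_bound (by fun_prop) 1 (ae_of_all _ fun y => ?_)
  rw [Real.norm_of_nonneg (Real.exp_pos _).le]
  exact exp_neg_norm_sub_sq_le_one hs x y

lemma integrable_gaussian_smul_sub [NormedSpace ℝ E] {s c : ℝ} (hs : 0 < s) (hc : 0 < c)
    (ν : Measure E) [IsFiniteMeasure ν] (x : E) :
    Integrable (fun y => (c * Real.exp (-‖x - y‖ ^ 2 / (2 * s))) • (y - x)) ν :=
  Integrable.of_bound (by fun_prop) (c * (1 + s))
    (ae_of_all _ fun y => norm_gaussian_smul_sub_le hs hc x y)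

lemma integral_gaussian_pos {s c : ℝ} (hs : 0 < s) (hc : 0 < c) (ν : Measure E)
    [IsFiniteMeasure ν] [NeZero ν] (x : E) :
    0 < ∫ y, c * Real.exp (-‖x - y‖ ^ 2 / (2 * s)) ∂ν := by
  rw [integral_const_mul]
  refine mul_pos hc (integral_exp_pos ?_)
  simpa using integrable_gaussian hs 1 ν x

/-- The gap between the unnormalized posterior mean and the observation. -/
lemma integral_gaussian_smul_sub [NormedSpace ℝ E] [CompleteSpace E] {s c : ℝ} (hs : 0 < s)
    (hc : 0 < c) (ν : Measure E) [IsFiniteMeasure ν] (x : E) :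
    ∫ y, (c * Real.exp (-‖x - y‖ ^ 2 / (2 * s))) • (y - x) ∂ν =
      (∫ y, (c * Real.exp (-‖x - y‖ ^ 2 / (2 * s))) • y ∂ν) -
        (∫ y, c * Real.exp (-‖x - y‖ ^ 2 / (2 * s)) ∂ν) • x := by
  have hx := (integrable_gaussian hs c ν x).smul_const x
  have hy : Integrable (fun y => (c * Real.exp (-‖x - y‖ ^ 2 / (2 * s))) • y) ν := by
    refine ((integrable_gaussian_smul_sub hs hc ν x).add hx).congr (ae_of_all _ fun y => ?_)
    simp [smul_sub]
  simp_rw [smul_sub]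
  rw [integral_sub hy hx, integral_smul_const]

/-- Differentiation under the integral sign for the Gaussian smoothing of a finite measure. -/
lemma hasGradientAt_integral_gaussian [InnerProductSpace ℝ E] [CompleteSpace E] {s c : ℝ}
    (hs : 0 < s) (hc : 0 < c) (ν : Measure E) [IsFiniteMeasure ν] (x : E) :
    HasGradientAt (fun z => ∫ y, c * Real.exp (-‖z - y‖ ^ 2 / (2 * s)) ∂ν)
      (s⁻¹ • ∫ y, (c * Real.exp (-‖x - y‖ ^ 2 / (2 * s))) • (y - x) ∂ν) x := by
  have hint := (integrable_gaussian_smul_sub hs hc ν x).smul s⁻¹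
  have hbound : ∀ z y : E,
      ‖innerSL ℝ (s⁻¹ • (c * Real.exp (-‖z - y‖ ^ 2 / (2 * s))) • (y - z))‖ ≤
        s⁻¹ * (c * (1 + s)) := fun z y => by
    rw [innerSL_apply_norm, norm_smul, Real.norm_of_nonneg (by positivity)]
    gcongr
    exact norm_gaussian_smul_sub_le hs hc z y
  have hmeas : AEStronglyMeasurable (fun y =>
      innerSL ℝ (s⁻¹ • (c * Real.exp (-‖x - y‖ ^ 2 / (2 * s))) • (y - x))) ν :=
    (innerSL ℝ).continuous.comp_aestronglyMeasurable hint.aestronglyMeasurable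
  have h := hasFDerivAt_integral_of_dominated_of_fderiv_le (μ := ν) (x₀ := x) Filter.univ_mem
    (Filter.Eventually.of_forall fun z => (integrable_gaussian hs c ν z).aestronglyMeasurable)
    (integrable_gaussian hs c ν x) hmeas (ae_of_all _ fun y z _ => hbound z y)
    (integrable_const _) (ae_of_all _ fun y z _ => hasFDerivAt_gaussian s c z y)
  rw [hasGradientAt_iff_hasFDerivAt]
  refine h.congr_fderiv ?_
  ext v
  rw [ContinuousLinearMap.integral_apply
    (Integrable.of_bound hmeas _ (ae_of_all _ fun y => hbound x y)), ← integral_smul]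
  simp only [innerSL_apply_apply, InnerProductSpace.toDual_apply_apply]
  simp_rw [real_inner_comm v]
  exact integral_inner hint v

end GaussianSmoothing

/-- Tweedie's formula in `ℝᵈ`: the Gaussian-smoothed density of a probability
measure is everywhere positive and differentiable, and `σ² ∇ log p_σ (x) = μ(x) − x`
where `μ(x)` is the posterior mean of the clean signal given the noisy observation. -/
theorem tweedie_formula_multidim (d : ℕ) (hd : 1 ≤ d)
    (p₀ : Measure (EuclideanSpace ℝ (Fin d))) [IsProbabilityMeasure p₀]
    (σ : ℝ) (hσ : 0 < σ)
    (pσ : EuclideanSpace ℝ (Fin d) → ℝ)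
    (hpσ : ∀ x, pσ x =
      ∫ y, (2 * Real.pi * σ ^ 2) ^ (-(d : ℝ) / 2) *
        Real.exp (-‖x - y‖ ^ 2 / (2 * σ ^ 2)) ∂p₀)
    (μ : EuclideanSpace ℝ (Fin d) → EuclideanSpace ℝ (Fin d))
    (hμ : ∀ x, μ x = (pσ x)⁻¹ •
      ∫ y, ((2 * Real.pi * σ ^ 2) ^ (-(d : ℝ) / 2) *
        Real.exp (-‖x - y‖ ^ 2 / (2 * σ ^ 2))) • y ∂p₀) :
    (∀ x, 0 < pσ x) ∧ Differentiable ℝ pσ ∧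
      ∀ x, σ ^ 2 • gradient (fun z => Real.log (pσ z)) x = μ x - x := by
  have hs : 0 < σ ^ 2 := by positivity
  have hc : 0 < (2 * Real.pi * σ ^ 2) ^ (-(d : ℝ) / 2) := by positivity
  have hpos : ∀ x, 0 < pσ x := fun x => hpσ x ▸ integral_gaussian_pos hs hc p₀ x
  have hgrad := hasGradientAt_integral_gaussian hs hc p₀
  simp_rw [integral_gaussian_smul_sub hs hc p₀, ← hpσ] at hgrad
  refine ⟨hpos, fun x => (hgrad x).differentiableAt, fun x => ?_⟩
  have hlog : HasGradientAt (fun z => Real.log (pσ z)) ((σ ^ 2)⁻¹ • (μ x - x)) x := by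
    rw [hasGradientAt_iff_hasFDerivAt]
    refine ((hgrad x).hasFDerivAt.log (hpos x).ne').congr_fderiv ?_
    rw [← map_smul, smul_comm, smul_sub, ← hμ, inv_smul_smul₀ (hpos x).ne']
  rw [hlog.gradient, smul_inv_smul₀ hs.ne']
end

section
/- Let f : ℝⁿ → ℝᵐ be continuously differentiable on an open neighborhood of θ ∈ ℝⁿ, let J = Df(θ) be its Jacobian at θ, assume Jᵀ·J is invertible, and let c ∈ ℝᵐ. Let r > 0 be such that f is continuously differentiable on the closed ball of radius r around θ, and suppose δ : (0, ε) → ℝⁿ is such that for each t ∈ (0, ε), δ(t) is a global minimizer over the closed ball B(0, r) of the objective u ↦ ‖f(θ) − f(θ − u) − t·c‖², and δ(t) → 0 as t → 0⁺. Then δ(t)/t → (Jᵀ·J)⁻¹·Jᵀ·c as t → 0⁺. -/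
open Matrix Filter Asymptotics Topology

/-- If `g` vanishes at `0` with derivative `A`, where `A` has a left inverse `P` such that
`A (P c)` is the orthogonal projection of `c` onto the range of `A`, then any curve `δ t → 0`
along which the residual `‖g u - t • c‖` is eventually at most its values at `u = 0` and `u = t • P c`
satisfies `δ t / t → P c`. -/
theorem tendsto_inv_smul_of_residual_le {E F : Type*}
    [NormedAddCommGroup E] [NormedSpace ℝ E] [NormedAddCommGroup F] [InnerProductSpace ℝ F]
    {g : E → F} {A : E →L[ℝ] F} {P : F →L[ℝ] E} {c : F} {δ : ℝ → E}
    (hg : HasFDerivAt g A 0) (hg0 : g 0 = 0) (hPA : ∀ x, P (A x) = x)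
    (horth : ∀ w, inner ℝ (A w) (A (P c) - c) = 0)
    (hδ : Tendsto δ (𝓝[>] 0) (𝓝 0))
    (hzero : ∀ᶠ t in 𝓝[>] (0 : ℝ), ‖g (δ t) - t • c‖ ≤ ‖t • c‖)
    (hproj : ∀ᶠ t in 𝓝[>] (0 : ℝ), ‖g (δ t) - t • c‖ ≤ ‖g (t • P c) - t • c‖) :
    Tendsto (fun t : ℝ => t⁻¹ • δ t) (𝓝[>] 0) (𝓝 (P c)) := by
  have hlin : (fun u => g u - A u) =o[𝓝 0] fun u => u := by
    simpa [hg0] using hg.isLittleO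
  have hlower : (fun u => u) =O[𝓝 0] A := by
    refine IsBigO.of_bound ‖P‖ (Eventually.of_forall fun u => ?_)
    simpa [hPA] using P.le_opNorm (A u)
  have hgrow : (fun u => u) =O[𝓝 0] g := by
    simpa using hlower.trans (hlin.trans_isBigO hlower).right_isBigO_add
  have hδt : δ =O[𝓝[>] 0] fun t : ℝ => t := by
    refine (hgrow.comp_tendsto hδ).trans (IsBigO.of_bound (2 * ‖c‖) ?_)
    filter_upwards [hzero] with t ht
    have := norm_sub_norm_le (g (δ t)) (t • c)
    rw [norm_smul] at ht this
    simp only [Function.comp_apply]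
    linarith
  have hv : Tendsto (fun t : ℝ => t • P c) (𝓝[>] 0) (𝓝 0) := by
    have : Tendsto (fun t : ℝ => t • P c) (𝓝 0) (𝓝 ((0 : ℝ) • P c)) :=
      tendsto_id.smul_const _
    rw [zero_smul] at this
    exact this.mono_left nhdsWithin_le_nhds
  have hvt : (fun t : ℝ => t • P c) =O[𝓝[>] 0] fun t : ℝ => t :=
    IsBigO.of_bound ‖P c‖ (Eventually.of_forall fun t => by rw [norm_smul, mul_comm])
  have herr₁ := (((hlin.comp_tendsto hδ).trans_isBigO hδt).norm_left).tendsto_div_nhds_zero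
  have herr₂ := (((hlin.comp_tendsto hv).trans_isBigO hvt).norm_left).tendsto_div_nhds_zero
  have herr := herr₁.add herr₂
  simp only [Function.comp_apply, add_zero] at herr
  set e : ℝ → ℝ := fun t =>
    ‖g (δ t) - A (δ t)‖ / t + ‖g (t • P c) - A (t • P c)‖ / t with he
  have hsq : Tendsto (fun t => (‖A (P c) - c‖ + e t) ^ 2 - ‖A (P c) - c‖ ^ 2) (𝓝[>] 0) (𝓝 0) := by
    have h := ((herr.const_add ‖A (P c) - c‖).pow 2).sub_const (‖A (P c) - c‖ ^ 2)
    rwa [add_zero, sub_self] at h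
  have hA : Tendsto (fun t : ℝ => A (t⁻¹ • δ t - P c)) (𝓝[>] 0) (𝓝 0) := by
    rw [tendsto_zero_iff_norm_tendsto_zero]
    have hsqrt := hsq.sqrt
    rw [Real.sqrt_zero] at hsqrt
    refine squeeze_zero' (Eventually.of_forall fun t => norm_nonneg _) ?_ hsqrt
    filter_upwards [hproj, self_mem_nhdsWithin] with t ht htpos
    have htpos : 0 < t := htpos
    apply Real.le_sqrt_of_sq_le
    have hpyth : ‖A (t⁻¹ • δ t) - c‖ ^ 2 =
        ‖A (t⁻¹ • δ t - P c)‖ ^ 2 + ‖A (P c) - c‖ ^ 2 := by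
      have := norm_add_sq_real (A (t⁻¹ • δ t - P c)) (A (P c) - c)
      rw [horth, mul_zero, add_zero] at this
      rw [← this, map_sub, sub_add_sub_cancel]
    have hscale (x : E) : ‖A x - t • c‖ = t * ‖A (t⁻¹ • x) - c‖ := by
      rw [← abs_of_pos htpos, ← Real.norm_eq_abs, ← norm_smul, smul_sub, map_smul, smul_smul,
        Real.norm_eq_abs, abs_of_pos htpos, mul_inv_cancel₀ htpos.ne', one_smul]
    have hle : ‖A (t⁻¹ • δ t) - c‖ ≤ ‖A (P c) - c‖ + e t := by
      have h₁ : ‖A (δ t) - t • c‖ ≤ ‖g (δ t) - A (δ t)‖ + ‖g (δ t) - t • c‖ := by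
        rw [norm_sub_rev (g (δ t)) (A (δ t))]
        exact norm_sub_le_norm_sub_add_norm_sub _ _ _
      have h₂ : ‖g (t • P c) - t • c‖ ≤
          ‖g (t • P c) - A (t • P c)‖ + ‖A (t • P c) - t • c‖ :=
        norm_sub_le_norm_sub_add_norm_sub _ _ _
      rw [hscale] at h₁ h₂
      rw [smul_smul, inv_mul_cancel₀ htpos.ne', one_smul] at h₂
      have het : t * e t =
          ‖g (δ t) - A (δ t)‖ + ‖g (t • P c) - A (t • P c)‖ := by
        simp only [he]
        field_simp
      refine le_of_mul_le_mul_left ?_ htpos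
      rw [mul_add, het]
      linarith
    have := pow_le_pow_left₀ (norm_nonneg _) hle 2
    linarith
  have hP := (P.continuous.tendsto 0).comp hA
  simp only [map_zero, Function.comp_def, hPA] at hP
  exact tendsto_sub_nhds_zero_iff.mp hP

/-- As the step size `t → 0⁺`, the constrained minimizer `δ(t)` of the discrete
objective `u ↦ ‖f(θ) − f(θ − u) − t·c‖²`, divided by `t`, converges to the
pulled-back probability-flow direction `(JᵀJ)⁻¹Jᵀc`. -/
theorem discrete_minimizer_recovers_pullback (n m : ℕ)
    (f : EuclideanSpace ℝ (Fin n) → EuclideanSpace ℝ (Fin m))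
    (θ : EuclideanSpace ℝ (Fin n)) (c : EuclideanSpace ℝ (Fin m))
    (J : Matrix (Fin m) (Fin n) ℝ)
    (hfθ : ∃ U : Set (EuclideanSpace ℝ (Fin n)), IsOpen U ∧ θ ∈ U ∧ ContDiffOn ℝ 1 f U)
    (hJ : (fderiv ℝ f θ : EuclideanSpace ℝ (Fin n) →ₗ[ℝ] EuclideanSpace ℝ (Fin m)) =
      Matrix.toEuclideanLin J)
    (hJJ : IsUnit (Jᵀ * J).det)
    (r : ℝ) (hr : 0 < r)
    (hf : ContDiffOn ℝ 1 f (Metric.closedBall θ r))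
    (ε : ℝ) (hε : 0 < ε)
    (δ : ℝ → EuclideanSpace ℝ (Fin n))
    (hmem : ∀ t ∈ Set.Ioo (0 : ℝ) ε, δ t ∈ Metric.closedBall (0 : EuclideanSpace ℝ (Fin n)) r)
    (hmin : ∀ t ∈ Set.Ioo (0 : ℝ) ε,
      ∀ u ∈ Metric.closedBall (0 : EuclideanSpace ℝ (Fin n)) r,
        ‖f θ - f (θ - δ t) - t • c‖ ^ 2 ≤ ‖f θ - f (θ - u) - t • c‖ ^ 2)
    (hδ0 : Tendsto δ (nhdsWithin 0 (Set.Ioi 0)) (nhds 0)) :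
    Tendsto (fun t : ℝ => t⁻¹ • δ t) (nhdsWithin 0 (Set.Ioi 0))
      (nhds (Matrix.toEuclideanLin ((Jᵀ * J)⁻¹ * Jᵀ) c)) := by
  obtain ⟨U, hUo, hθU, hfU⟩ := hfθ
  have hdiff : DifferentiableAt ℝ f θ :=
    (hfU.contDiffAt (hUo.mem_nhds hθU)).differentiableAt one_ne_zero
  have hA (x : EuclideanSpace ℝ (Fin n)) : fderiv ℝ f θ x = Matrix.toEuclideanLin J x :=
    LinearMap.congr_fun hJ x
  have hg : HasFDerivAt (fun u => f θ - f (θ - u)) (fderiv ℝ f θ) 0 := by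
    have h : HasFDerivAt f (fderiv ℝ f θ) (θ - 0) := by simpa using hdiff.hasFDerivAt
    simpa using (h.comp 0 ((hasFDerivAt_id 0).const_sub θ)).const_sub (f θ)
  have hIoo : ∀ᶠ t in 𝓝[>] (0 : ℝ), t ∈ Set.Ioo 0 ε := Ioo_mem_nhdsGT hε
  have hscaled : Tendsto (fun t : ℝ => t • Matrix.toEuclideanLin ((Jᵀ * J)⁻¹ * Jᵀ) c)
      (𝓝[>] 0) (𝓝 0) := by
    have : Tendsto (fun t : ℝ => t • Matrix.toEuclideanLin ((Jᵀ * J)⁻¹ * Jᵀ) c) (𝓝 0)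
        (𝓝 ((0 : ℝ) • Matrix.toEuclideanLin ((Jᵀ * J)⁻¹ * Jᵀ) c)) := tendsto_id.smul_const _
    rw [zero_smul] at this
    exact this.mono_left nhdsWithin_le_nhds
  refine tendsto_inv_smul_of_residual_le
    (P := LinearMap.toContinuousLinearMap (Matrix.toEuclideanLin ((Jᵀ * J)⁻¹ * Jᵀ)))
    hg (by simp) (fun x => ?_) (fun w => ?_) hδ0 ?_ ?_
  · rw [hA]
    simp [Matrix.toLpLin_apply, Matrix.nonsing_inv_mul _ hJJ]
  · rw [hA, hA, ← LinearMap.adjoint_inner_right, ← Matrix.toEuclideanLin_conjTranspose_eq_adjoint,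
      map_sub, Matrix.conjTranspose_eq_transpose_of_trivial]
    simp [Matrix.toLpLin_apply, ← Matrix.mul_assoc, Matrix.mul_nonsing_inv _ hJJ]
  · filter_upwards [hIoo] with t ht
    simpa using (sq_le_sq₀ (norm_nonneg _) (norm_nonneg _)).mp (hmin t ht 0 (by simp [hr.le]))
  · filter_upwards [hIoo, hscaled.eventually (Metric.closedBall_mem_nhds 0 hr)] with t ht hu
    exact (sq_le_sq₀ (norm_nonneg _) (norm_nonneg _)).mp (hmin t ht _ hu)
end

section
/- Let p₀ be a probability measure on ℝ, σ > 0, and define p_σ(x) = ∫ φ(x; y, σ²) dp₀(y) and μ(x) = (1/p_σ(x)) · ∫ y · φ(x; y, σ²) dp₀(y). Then for every x ∈ ℝ, p_σ(x) > 0, μ(x) is well defined (the integral converges absolutely), p_σ is differentiable at x, and the one-dimensional Tweedie formula holds: (log p_σ)'(x) = (μ(x) − x)/σ². Equivalently, defining the optimal noise predictor ε̂(x) = (x − μ(x))/σ, one has (log p_σ)'(x) = −ε̂(x)/σ. -/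
open Real MeasureTheory

lemma gaussianPDF_pos {v : ℝ} (hv : 0 < v) (m x : ℝ) : 0 < gaussianPDF m v x := by
  unfold gaussianPDF
  positivity

lemma gaussianPDF_le {v : ℝ} (hv : 0 < v) (m x : ℝ) :
    gaussianPDF m v x ≤ (2 * Real.pi * v) ^ (-(1 : ℝ) / 2) := by
  unfold gaussianPDF
  refine mul_le_of_le_one_right (by positivity) (Real.exp_le_one_iff.mpr ?_)
  rw [neg_div]
  exact neg_nonpos.mpr (by positivity)

lemma continuous_gaussianPDF_mean (v x : ℝ) : Continuous fun m => gaussianPDF m v x := by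
  unfold gaussianPDF
  fun_prop

lemma abs_mul_exp_neg_sq_div_le {v : ℝ} (hv : 0 < v) (t : ℝ) :
    |t| * Real.exp (-t ^ 2 / (2 * v)) ≤ 1 + v / 2 := by
  have hs : 0 ≤ t ^ 2 / (2 * v) := by positivity
  have hexp := Real.add_one_le_exp (t ^ 2 / (2 * v))
  have hamgm : |t| ≤ t ^ 2 / (2 * v) + v / 2 := by
    have hsq : t ^ 2 / (2 * v) + v / 2 - |t| = (|t| - v) ^ 2 / (2 * v) := by
      rw [← sq_abs t]
      field_simp
      ring
    have : 0 ≤ (|t| - v) ^ 2 / (2 * v) := by positivity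
    linarith
  rw [neg_div, Real.exp_neg, ← div_eq_mul_inv, div_le_iff₀ (Real.exp_pos _)]
  nlinarith

lemma abs_sub_mul_gaussianPDF_le {v : ℝ} (hv : 0 < v) (m x : ℝ) :
    |(m - x) * gaussianPDF m v x| ≤ (2 * Real.pi * v) ^ (-(1 : ℝ) / 2) * (1 + v / 2) := by
  rw [abs_mul, abs_of_pos (gaussianPDF_pos hv m x), abs_sub_comm, gaussianPDF, mul_left_comm]
  exact mul_le_mul_of_nonneg_left (abs_mul_exp_neg_sq_div_le hv _) (by positivity)

lemma hasDerivAt_gaussianPDF {v : ℝ} (hv : 0 < v) (m x : ℝ) :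
    HasDerivAt (gaussianPDF m v) ((m - x) * gaussianPDF m v x / v) x := by
  have h : HasDerivAt (fun x => -(x - m) ^ 2 / (2 * v)) ((m - x) / v) x := by
    refine ((((hasDerivAt_id x).sub_const m).pow 2).neg.div_const (2 * v)).congr_deriv ?_
    simp only [id]
    field_simp
    push_cast
    ring
  refine (h.exp.const_mul ((2 * Real.pi * v) ^ (-(1 : ℝ) / 2))).congr_deriv ?_
  unfold gaussianPDF
  ring

lemma integrable_gaussianPDF_mean (p : Measure ℝ) [IsFiniteMeasure p] {v : ℝ} (hv : 0 < v) (x : ℝ) :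
    Integrable (fun m => gaussianPDF m v x) p := by
  refine .of_bound (continuous_gaussianPDF_mean v x).aestronglyMeasurable
    ((2 * Real.pi * v) ^ (-(1 : ℝ) / 2)) (.of_forall fun m => ?_)
  rw [Real.norm_of_nonneg (gaussianPDF_pos hv m x).le]
  exact gaussianPDF_le hv m x

lemma integrable_sub_mul_gaussianPDF (p : Measure ℝ) [IsFiniteMeasure p] {v : ℝ} (hv : 0 < v) (x : ℝ) :
    Integrable (fun m => (m - x) * gaussianPDF m v x) p :=
  .of_bound (((continuous_id.sub continuous_const).mul
    (continuous_gaussianPDF_mean v x)).aestronglyMeasurable) _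
    (.of_forall fun m => abs_sub_mul_gaussianPDF_le hv m x)

lemma integrable_mul_gaussianPDF (p : Measure ℝ) [IsFiniteMeasure p] {v : ℝ} (hv : 0 < v) (x : ℝ) :
    Integrable (fun m => m * gaussianPDF m v x) p := by
  refine ((integrable_sub_mul_gaussianPDF p hv x).add
    ((integrable_gaussianPDF_mean p hv x).const_mul x)).congr (.of_forall fun m => ?_)
  simp only [Pi.add_apply]
  ring

lemma integral_gaussianPDF_pos (p : Measure ℝ) [IsFiniteMeasure p] [NeZero p] {v : ℝ}
    (hv : 0 < v) (x : ℝ) : 0 < ∫ m, gaussianPDF m v x ∂p := by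
  rw [integral_pos_iff_support_of_nonneg (fun m => (gaussianPDF_pos hv m x).le)
    (integrable_gaussianPDF_mean p hv x)]
  have hsupp : Function.support (fun m => gaussianPDF m v x) = Set.univ :=
    Set.eq_univ_of_forall fun m => (gaussianPDF_pos hv m x).ne'
  rw [hsupp]
  exact NeZero.pos _

lemma hasDerivAt_integral_gaussianPDF (p : Measure ℝ) [IsFiniteMeasure p] {v : ℝ} (hv : 0 < v) (x : ℝ) :
    HasDerivAt (fun z => ∫ m, gaussianPDF m v z ∂p)
      (((∫ m, m * gaussianPDF m v x ∂p) - x * ∫ m, gaussianPDF m v x ∂p) / v) x := by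
  have h := (hasDerivAt_integral_of_dominated_loc_of_deriv_le (μ := p) (x₀ := x)
    (F := fun z m => gaussianPDF m v z) (F' := fun z m => (m - z) * gaussianPDF m v z / v)
    (bound := fun _ => (2 * Real.pi * v) ^ (-(1 : ℝ) / 2) * (1 + v / 2) / v)
    Filter.univ_mem
    (.of_forall fun z => (continuous_gaussianPDF_mean v z).aestronglyMeasurable)
    (integrable_gaussianPDF_mean p hv x)
    ((integrable_sub_mul_gaussianPDF p hv x).div_const v).aestronglyMeasurable
    (.of_forall fun m z _ => ?_) (integrable_const _)
    (.of_forall fun m z _ => hasDerivAt_gaussianPDF hv m z)).2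
  · refine h.congr_deriv ?_
    rw [integral_div, ← integral_const_mul,
      ← integral_sub (integrable_mul_gaussianPDF p hv x)
        ((integrable_gaussianPDF_mean p hv x).const_mul x)]
    simp only [sub_mul]
  · rw [norm_div, Real.norm_of_nonneg hv.le]
    gcongr
    exact abs_sub_mul_gaussianPDF_le hv m z

/-- One-dimensional Tweedie formula: for `p_σ(x) = ∫ φ(x; y, σ²) dp₀(y)` and the
posterior mean `μ(x)`, we have `p_σ(x) > 0`, `μ(x)` is well defined, `p_σ` is
differentiable, `(log p_σ)'(x) = (μ(x) − x)/σ²`, and with the optimal noise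
predictor `epsHat(x) = (x − μ(x))/σ`, `(log p_σ)'(x) = −epsHat(x)/σ`. -/
theorem tweedie_formula_one_dim (p₀ : Measure ℝ) [IsProbabilityMeasure p₀]
    (σ : ℝ) (hσ : 0 < σ)
    (pσ : ℝ → ℝ) (hpσ : ∀ x, pσ x = ∫ y, gaussianPDF y (σ ^ 2) x ∂p₀)
    (μ : ℝ → ℝ) (hμ : ∀ x, μ x = (pσ x)⁻¹ * ∫ y, y * gaussianPDF y (σ ^ 2) x ∂p₀)
    (epsHat : ℝ → ℝ) (hepsHat : ∀ x, epsHat x = (x - μ x) / σ) :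
    ∀ x : ℝ,
      0 < pσ x ∧
      Integrable (fun y => y * gaussianPDF y (σ ^ 2) x) p₀ ∧
      DifferentiableAt ℝ pσ x ∧
      deriv (fun z => Real.log (pσ z)) x = (μ x - x) / σ ^ 2 ∧
      deriv (fun z => Real.log (pσ z)) x = -epsHat x / σ := by
  intro x
  have hv : 0 < σ ^ 2 := by positivity
  have hpos : 0 < pσ x := hpσ x ▸ integral_gaussianPDF_pos p₀ hv x
  have hderiv := hasDerivAt_integral_gaussianPDF p₀ hv x
  rw [← funext hpσ, ← hpσ x] at hderiv
  have hscore : deriv (fun z => Real.log (pσ z)) x = (μ x - x) / σ ^ 2 := by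
    rw [(hderiv.log hpos.ne').deriv, hμ x]
    field_simp
  refine ⟨hpos, integrable_mul_gaussianPDF p₀ hv x, hderiv.differentiableAt, hscore, ?_⟩
  rw [hscore, hepsHat x]
  field_simp
  ring
end
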